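/- (Berger's inequality) Let (V, J) be as in the context and R a Kähler algebraic curvature tensor on (V, J). Suppose there are constants 0 < λ ≤ Λ such that λ ≤ H(X) ≤ Λ for every unit vector X ∈ V. Then for all unit vectors X, Y such that X, JX, Y, JY are pairwise orthogonal, the orthogonal bisectional curvature satisfies R(X, Y, Y, X) + R(X, JY, JY, X) ≥ λ − Λ/2. -/

import Mathlib

open scoped RealInnerProductSpace

/-- Parallelogram-type identity for the holomorphic curvature quartic `R(Z, JZ, JZ, Z)` of a
Kähler algebraic curvature tensor. -/
theorem holomorphic_quartic_add_add_sub {V : Type*} [AddCommGroup V] [Module ℝ V]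
    (J : V →ₗ[ℝ] V) (hJ2 : ∀ X : V, J (J X) = -X)
    (R : V →ₗ[ℝ] V →ₗ[ℝ] V →ₗ[ℝ] V →ₗ[ℝ] ℝ)
    (hanti : ∀ X Y Z W : V, R X Y Z W = - R Y X Z W)
    (hsymm : ∀ X Y Z W : V, R X Y Z W = R Z W X Y)
    (hbianchi : ∀ X Y Z W : V, R X Y Z W + R Y Z X W + R Z X Y W = 0)
    (hkahler : ∀ X Y Z W : V, R (J X) (J Y) Z W = R X Y Z W) (X Y : V) :
    R (X + Y) (J (X + Y)) (J (X + Y)) (X + Y) + R (X - Y) (J (X - Y)) (J (X - Y)) (X - Y) =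
      2 * R X (J X) (J X) X + 2 * R Y (J Y) (J Y) Y + 4 * R X Y Y X
        + 12 * R X (J Y) (J Y) X := by
  have hsub : ∀ A B C D E : V, R (A - B) C D E = R A C D E - R B C D E := fun A B C D E => by
    rw [hanti, map_sub, LinearMap.sub_apply, LinearMap.sub_apply, hanti A, hanti B]
    ring
  have hJl : ∀ A B C D : V, R (J A) B C D = - R A (J B) C D := fun A B C D => by
    have h := hkahler A (J B) C D
    rw [hJ2, map_neg, LinearMap.neg_apply, LinearMap.neg_apply] at h
    linarith
  have hanti' : ∀ A B C D : V, R A B C D = - R A B D C := fun A B C D => by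
    rw [hsymm A B C D, hanti, hsymm D C A B]
  have hJr : ∀ A B C D : V, R A B (J C) D = - R A B C (J D) := fun A B C D => by
    rw [hsymm, hJl, hsymm C]
  have hswap : ∀ A B C D : V, R A (J B) C D = R B (J A) C D := fun A B C D => by
    rw [hanti, hJl, neg_neg]
  have hswap' : ∀ A B C D : V, R A B (J C) D = R A B (J D) C := fun A B C D => by
    rw [hanti', hJr A B D C]
  have hbisec : R X (J X) (J Y) Y = R X Y Y X + R X (J Y) (J Y) X := by
    have hb := hbianchi X (J X) (J Y) Y
    rw [hkahler, hanti (J Y) X, hswap' X (J Y) X Y, hanti' X Y X Y] at hb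
    linarith
  have hbisec' : R Y (J Y) (J X) X = R X Y Y X + R X (J Y) (J Y) X := by
    rw [← hbisec, hsymm, hanti, hanti', neg_neg]
  have hmix : R X (J Y) (J X) Y = R X (J Y) (J Y) X := hswap' _ _ _ _
  have hmix' : R Y (J X) (J Y) X = R X (J Y) (J Y) X := hswap _ _ _ _
  have hmix'' : R Y (J X) (J X) Y = R X (J Y) (J Y) X := by rw [hswap, hswap']
  simp only [map_add, map_sub, hsub, LinearMap.add_apply, LinearMap.sub_apply]
  linarith

/-- Berger's inequality: pinching of holomorphic sectional curvature bounds the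
orthogonal bisectional curvature from below. -/
theorem orthBisec_lower_bound_of_holomorphic_pinching
    {V : Type*} [NormedAddCommGroup V] [InnerProductSpace ℝ V]
    [FiniteDimensional ℝ V]
    (J : V →ₗ[ℝ] V)
    (hJ2 : ∀ X : V, J (J X) = -X)
    (hJinner : ∀ X Y : V, ⟪J X, J Y⟫ = ⟪X, Y⟫)
    (R : V →ₗ[ℝ] V →ₗ[ℝ] V →ₗ[ℝ] V →ₗ[ℝ] ℝ)
    (hanti : ∀ X Y Z W : V, R X Y Z W = - R Y X Z W)
    (hsymm : ∀ X Y Z W : V, R X Y Z W = R Z W X Y)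
    (hbianchi : ∀ X Y Z W : V, R X Y Z W + R Y Z X W + R Z X Y W = 0)
    (hkahler : ∀ X Y Z W : V, R (J X) (J Y) Z W = R X Y Z W)
    (H : V → ℝ)
    (hH : ∀ X : V, H X = R X (J X) (J X) X / ‖X‖ ^ 4)
    (lam Lam : ℝ) (hlam : 0 < lam) (hlamLam : lam ≤ Lam)
    (hpinch : ∀ Z : V, ‖Z‖ = 1 → lam ≤ H Z ∧ H Z ≤ Lam)
    (X Y : V) (hX : ‖X‖ = 1) (hY : ‖Y‖ = 1)
    (h1 : ⟪X, J X⟫ = 0) (h2 : ⟪X, Y⟫ = 0) (h3 : ⟪X, J Y⟫ = 0)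
    (h4 : ⟪J X, Y⟫ = 0) (h5 : ⟪J X, J Y⟫ = 0) (h6 : ⟪Y, J Y⟫ = 0)
    :
    lam - Lam / 2 ≤ R X Y Y X + R X (J Y) (J Y) X := by
  have hJnorm : ∀ A : V, ‖J A‖ = ‖A‖ := fun A => by
    rw [@norm_eq_sqrt_real_inner V, @norm_eq_sqrt_real_inner V, hJinner]
  have hquartic : ∀ A : V, ‖A‖ = 1 → R A (J A) (J A) A ≤ Lam := fun A hA => by
    have h := (hpinch A hA).2
    rwa [hH, hA, one_pow, div_one] at h
  have hlower : ∀ A : V, ⟪A, A⟫ = 2 → 4 * lam ≤ R A (J A) (J A) A := fun A hA => by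
    have hsq : ‖A‖ ^ 2 = 2 := by rw [← real_inner_self_eq_norm_sq, hA]
    have hA0 : ‖A‖ ≠ 0 := fun h0 => by norm_num [h0] at hsq
    have h := (hpinch (‖A‖⁻¹ • A) (by rw [norm_smul, norm_inv, norm_norm, inv_mul_cancel₀ hA0])).1
    have hinv : ‖A‖⁻¹ ^ 2 = 1 / 2 := by rw [inv_pow, hsq, one_div]
    rw [hH, norm_smul, norm_inv, norm_norm, inv_mul_cancel₀ hA0, one_pow, div_one] at h
    simp only [map_smul, LinearMap.smul_apply, smul_eq_mul] at h
    have e : ‖A‖⁻¹ * (‖A‖⁻¹ * (‖A‖⁻¹ * (‖A‖⁻¹ * R A (J A) (J A) A))) =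
        (‖A‖⁻¹ ^ 2) ^ 2 * R A (J A) (J A) A := by ring
    rw [e, hinv] at h
    linarith
  have hXX : ⟪X, X⟫ = 1 := by rw [real_inner_self_eq_norm_sq, hX, one_pow]
  have hYY : ⟪Y, Y⟫ = 1 := by rw [real_inner_self_eq_norm_sq, hY, one_pow]
  have hadd : ∀ B : V, ⟪X, B⟫ = 0 → ⟪B, B⟫ = 1 → ⟪X + B, X + B⟫ = 2 := fun B h0 hB => by
    rw [real_inner_add_add_self, hXX, h0, hB]; norm_num
  have hsub : ∀ B : V, ⟪X, B⟫ = 0 → ⟪B, B⟫ = 1 → ⟪X - B, X - B⟫ = 2 := fun B h0 hB => by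
    rw [real_inner_sub_sub_self, hXX, h0, hB]; norm_num
  have hJYY : ⟪J Y, J Y⟫ = 1 := by rw [hJinner, hYY]
  have e1 := holomorphic_quartic_add_add_sub J hJ2 R hanti hsymm hbianchi hkahler X Y
  have e2 := holomorphic_quartic_add_add_sub J hJ2 R hanti hsymm hbianchi hkahler X (J Y)
  have hneg : R X (J (J Y)) (J (J Y)) X = R X Y Y X := by
    simp only [hJ2, map_neg, LinearMap.neg_apply, neg_neg]
  rw [hneg] at e2
  linarith [hlower _ (hadd Y h2 hYY), hlower _ (hsub Y h2 hYY), hlower _ (hadd (J Y) h3 hJYY),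
    hlower _ (hsub (J Y) h3 hJYY), hquartic X hX, hquartic Y hY,
    hquartic (J Y) (by rw [hJnorm, hY])]
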